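/- For all z ≥ 0 and y ∈ ℝ³: |D_zX(z,y)| ≤ c₂ c₇ R_* (1 + χ₀ + R_* z)^{2a} |y| (1+|y|)^{-2a}, and also |D_zX(z,y)| ≤ c₃ c₇ R_* (1 + χ₀ + R_* z)^{a} |y|^{1-a} (1+|y|)^{-a}, where c₂ = 2^a min{1, χ₀}^{-a} min{a₀, a_N}^{-1}, c₃ = a_N^{a-1}, and c₇ = √3 · 2^{ᾱ_N}/min{a₀, a_N}. -/

import Mathlib

open Real

noncomputable section

abbrev E3 := EuclideanSpace ℝ (Fin 3)

/-- The cross product `x × y` in `ℝ³`. -/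
def cross3 (x y : E3) : E3 :=
  (WithLp.equiv 2 (Fin 3 → ℝ)).symm
    ![x 1 * y 2 - x 2 * y 1, x 2 * y 0 - x 0 * y 2, x 0 * y 1 - x 1 * y 0]

/-- The function `g(s) = Σ aᵢ s^{ᾱᵢ}` (with `0⁰ = 1`, as for `Real.rpow`). -/
def gFun (N : ℕ) (α' A : Fin (N + 1) → ℝ) (s : ℝ) : ℝ := ∑ i, A i * s ^ α' i

/-- The Frobenius (Euclidean) norm of the Jacobian matrix of `y ↦ X z y` at `y`. -/
def frobDy (X : ℝ → E3 → E3) (z : ℝ) (y : E3) : ℝ :=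
  Real.sqrt (∑ i, ∑ j, (fderiv ℝ (fun y' => X z y') y (EuclideanSpace.single j 1) i) ^ 2)

/-! ### The cross product -/

lemma cross3_sub (k x y : E3) : cross3 k (x - y) = cross3 k x - cross3 k y := by
  ext i
  fin_cases i <;> simp [cross3] <;> ring

lemma inner_cross3_self (k x : E3) : inner ℝ (cross3 k x) x = 0 := by
  simp [cross3, PiLp.inner_apply, Fin.sum_univ_three]
  ring

lemma norm_cross3_le (k x : E3) : ‖cross3 k x‖ ≤ ‖k‖ * ‖x‖ := by
  refine abs_le_of_sq_le_sq' ?_ (by positivity) |>.2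
  rw [mul_pow, EuclideanSpace.real_norm_sq_eq, EuclideanSpace.real_norm_sq_eq,
    EuclideanSpace.real_norm_sq_eq]
  simp only [cross3, Fin.sum_univ_three, WithLp.equiv_symm_apply, Matrix.cons_val]
  nlinarith [sq_nonneg (k 0 * x 0 + k 1 * x 1 + k 2 * x 2)]

/-! ### The function `g` -/

section gFun

variable {N : ℕ} {α' A : Fin (N + 1) → ℝ}

lemma gFun_mono (hα : ∀ i, 0 ≤ α' i) (hA : ∀ i, 0 < A i) {s t : ℝ} (hs : 0 ≤ s) (hst : s ≤ t) :
    gFun N α' A s ≤ gFun N α' A t :=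
  Finset.sum_le_sum fun i _ =>
    mul_le_mul_of_nonneg_left (Real.rpow_le_rpow hs hst (hα i)) (hA i).le

lemma continuous_gFun (hα : ∀ i, 0 ≤ α' i) : Continuous (gFun N α' A) :=
  continuous_finsetSum _ fun i _ => continuous_const.mul (Real.continuous_rpow_const (hα i))

lemma gFun_le (hα : ∀ i, α' i ≤ α' (Fin.last N)) (hA : ∀ i, 0 < A i) {t : ℝ} (ht : 1 ≤ t) :
    gFun N α' A t ≤ (∑ i, A i) * t ^ α' (Fin.last N) := by
  rw [Finset.sum_mul]
  exact Finset.sum_le_sum fun i _ =>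
    mul_le_mul_of_nonneg_left (Real.rpow_le_rpow_of_exponent_le ht (hα i)) (hA i).le

lemma le_gFun (hN : 1 ≤ N) (hα0 : α' 0 = 0) (hA : ∀ i, 0 < A i) {s : ℝ} (hs : 0 ≤ s) :
    A 0 + A (Fin.last N) * s ^ α' (Fin.last N) ≤ gFun N α' A s := by
  have hne : (0 : Fin (N + 1)) ≠ Fin.last N := by
    intro h
    have := congrArg Fin.val h
    simp at this
    omega
  have h := Finset.sum_le_sum_of_subset_of_nonneg (f := fun i => A i * s ^ α' i)
    (Finset.subset_univ {0, Fin.last N})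
    fun i _ _ => mul_nonneg (hA i).le (Real.rpow_nonneg hs _)
  rw [Finset.sum_pair hne] at h
  simpa [gFun, hα0] using h

end gFun

/-- Radial fields `v ↦ g(|v|) v` with `g` nondecreasing are strongly monotone. -/
lemma inner_smul_sub_smul_ge {E : Type*} [NormedAddCommGroup E] [InnerProductSpace ℝ E]
    {g₁ g₂ : ℝ} {u v : E} (h : 0 ≤ (g₁ - g₂) * (‖u‖ - ‖v‖)) :
    (g₁ + g₂) / 2 * ‖u - v‖ ^ 2 ≤ inner ℝ (g₁ • u - g₂ • v) (u - v) := by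
  have h2 : 0 ≤ (g₁ - g₂) * (‖u‖ - ‖v‖) * (‖u‖ + ‖v‖) := mul_nonneg h (by positivity)
  rw [norm_sub_sq_real]
  simp only [inner_sub_left, inner_sub_right, real_inner_smul_left, real_inner_self_eq_norm_sq]
  rw [real_inner_comm u v]
  nlinarith

/-- Two solutions of `g(|v|) v + b k × v = y` for different `b` are close. -/
lemma norm_sub_le_of_cross3_eq {k : E3} (hk : ‖k‖ = 1) {g₁ g₂ b₁ b₂ : ℝ} {u v y : E3}
    (h : 0 ≤ (g₁ - g₂) * (‖u‖ - ‖v‖))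
    (hu : g₁ • u + b₁ • cross3 k u = y) (hv : g₂ • v + b₂ • cross3 k v = y) :
    (g₁ + g₂) / 2 * ‖u - v‖ ≤ |b₁ - b₂| * ‖v‖ := by
  rcases eq_or_lt_of_le (norm_nonneg (u - v)) with h0 | hpos
  · rw [← h0, mul_zero]
    positivity
  have hdiff : g₁ • u - g₂ • v = -(b₁ • cross3 k (u - v)) - (b₁ - b₂) • cross3 k v := by
    rw [cross3_sub, sub_smul, smul_sub]
    have := hu.trans hv.symm
    rw [← sub_eq_zero] at this ⊢
    rw [← this]
    abel
  have hmono := inner_smul_sub_smul_ge h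
  rw [hdiff, inner_sub_left, inner_neg_left, real_inner_smul_left, real_inner_smul_left,
    inner_cross3_self] at hmono
  have hcs : -((b₁ - b₂) * inner ℝ (cross3 k v) (u - v)) ≤ |b₁ - b₂| * (‖v‖ * ‖u - v‖) := by
    refine (neg_le_abs _).trans ?_
    rw [abs_mul]
    refine mul_le_mul_of_nonneg_left ((abs_real_inner_le_norm _ _).trans ?_) (abs_nonneg _)
    have := norm_cross3_le k v
    rw [hk, one_mul] at this
    gcongr
  refine le_of_mul_le_mul_right ?_ hpos
  nlinarith

lemma mul_norm_le_of_cross3_eq {k : E3} {g b : ℝ} {v y : E3}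
    (hv : g • v + b • cross3 k v = y) : g * ‖v‖ ≤ ‖y‖ := by
  rcases eq_or_lt_of_le (norm_nonneg v) with h0 | hpos
  · rw [← h0, mul_zero]
    positivity
  have h := real_inner_le_norm y v
  rw [← hv, inner_add_left, real_inner_smul_left, real_inner_smul_left, inner_cross3_self,
    real_inner_self_eq_norm_sq, hv] at h
  refine le_of_mul_le_mul_right ?_ hpos
  nlinarith

lemma norm_le_of_cross3_eq {k : E3} (hk : ‖k‖ = 1) {g b : ℝ} (hg : 0 ≤ g) (hb : 0 ≤ b)
    {v y : E3} (hv : g • v + b • cross3 k v = y) : ‖y‖ ≤ (g + b) * ‖v‖ := by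
  have h := norm_cross3_le k v
  rw [hk, one_mul] at h
  calc ‖y‖ ≤ ‖g • v‖ + ‖b • cross3 k v‖ := hv ▸ norm_add_le _ _
    _ = g * ‖v‖ + b * ‖cross3 k v‖ := by
        rw [norm_smul, norm_smul, Real.norm_of_nonneg hg, Real.norm_of_nonneg hb]
    _ ≤ (g + b) * ‖v‖ := by nlinarith

/-- The derivative in `z` of the inverse of `v ↦ g(|v|) v + R z (k × v)`. -/
lemma gFun_mul_norm_deriv_le {N : ℕ} {α' A : Fin (N + 1) → ℝ} (hα : ∀ i, 0 ≤ α' i)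
    (hA : ∀ i, 0 < A i) {k : E3} (hk : ‖k‖ = 1) {R : ℝ} (hR : 0 ≤ R) {V : ℝ → E3} {y : E3}
    (hV : ∀ z, gFun N α' A ‖V z‖ • V z + (R * z) • cross3 k (V z) = y) {z : ℝ}
    (hd : DifferentiableAt ℝ V z) :
    gFun N α' A ‖V z‖ * ‖deriv V z‖ ≤ R * ‖V z‖ := by
  have hslope := (hasDerivAt_iff_tendsto_slope.1 hd.hasDerivAt).norm
  have hg : Filter.Tendsto (fun t => (gFun N α' A ‖V t‖ + gFun N α' A ‖V z‖) / 2)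
      (nhdsWithin z {z}ᶜ) (nhds ((gFun N α' A ‖V z‖ + gFun N α' A ‖V z‖) / 2)) :=
    ((((continuous_gFun hα).continuousAt.comp hd.continuousAt.norm).add
      continuousAt_const).div_const 2).tendsto.mono_left nhdsWithin_le_nhds
  rw [add_self_div_two] at hg
  refine le_of_tendsto (hg.mul hslope) ?_
  filter_upwards [self_mem_nhdsWithin] with t ht
  have hne : 0 < |t - z| := abs_pos.2 (sub_ne_zero.2 ht)
  have hmono : 0 ≤ (gFun N α' A ‖V t‖ - gFun N α' A ‖V z‖) * (‖V t‖ - ‖V z‖) := by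
    rcases le_total ‖V t‖ ‖V z‖ with h | h
    · exact mul_nonneg_of_nonpos_of_nonpos
        (sub_nonpos.2 (gFun_mono hα hA (norm_nonneg _) h)) (sub_nonpos.2 h)
    · exact mul_nonneg (sub_nonneg.2 (gFun_mono hα hA (norm_nonneg _) h)) (sub_nonneg.2 h)
  have key := norm_sub_le_of_cross3_eq hk hmono (hV t) (hV z)
  rw [← mul_sub, abs_mul, abs_of_nonneg hR] at key
  rw [slope_def_module, norm_smul, norm_inv, Real.norm_eq_abs, ← mul_assoc, mul_right_comm,
    ← div_eq_mul_inv, div_le_iff₀ hne]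
  linarith

lemma one_add_rpow_le {s p : ℝ} (hs : 0 ≤ s) (hp : 0 ≤ p) :
    (1 + s) ^ p ≤ 2 ^ p * (1 + s ^ p) := by
  have hs' := Real.rpow_nonneg hs p
  rcases le_total s 1 with h | h
  · calc (1 + s) ^ p ≤ 2 ^ p := Real.rpow_le_rpow (by linarith) (by linarith) hp
      _ ≤ 2 ^ p * (1 + s ^ p) := le_mul_of_one_le_right (by positivity) (by linarith)
  · calc (1 + s) ^ p ≤ (2 * s) ^ p := Real.rpow_le_rpow (by linarith) (by linarith) hp
      _ = 2 ^ p * s ^ p := Real.mul_rpow (by norm_num) hs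
      _ ≤ 2 ^ p * (1 + s ^ p) := by gcongr; linarith


/-- The growth of `Y` in terms of any `t ≥ max 1 s`. -/
lemma one_add_rpow_le_of_growth {p a χ b G s t Y : ℝ} (hp : 0 ≤ p) (ha : 0 ≤ a)
    (hpa : (1 + p) * a = p) (hχ : 0 ≤ χ) (hb : 0 ≤ b) (hs : 0 ≤ s) (hY : 0 ≤ Y) (ht : 1 ≤ t)
    (hst : s ≤ t) (hGt : G ≤ χ * t ^ p) (hup : Y ≤ (G + b) * s) :
    (1 + Y) ^ a ≤ (1 + χ + b) ^ a * t ^ p := by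
  have ht0 : 0 < t := by linarith
  have htp : 1 ≤ t ^ p := Real.one_le_rpow ht hp
  have h1 : 1 + Y ≤ (1 + χ + b) * t ^ (1 + p) := by
    rw [Real.rpow_add ht0, Real.rpow_one]
    have h2 : (G + b) * s ≤ ((χ + b) * t ^ p) * t := by
      apply mul_le_mul _ hst hs (by positivity)
      nlinarith
    nlinarith [mul_le_mul ht htp zero_le_one ht0.le]
  calc (1 + Y) ^ a ≤ ((1 + χ + b) * t ^ (1 + p)) ^ a :=
        Real.rpow_le_rpow (by positivity) h1 ha
    _ = (1 + χ + b) ^ a * t ^ p := by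
      rw [Real.mul_rpow (by positivity) (by positivity), ← Real.rpow_mul ht0.le, hpa]

lemma inv_le_of_growth {p a m T G s Y : ℝ} (hp : 0 ≤ p) (hm : 0 < m) (hT : 0 < T) (hs : 0 ≤ s)
    (hY : 0 ≤ Y) (hGm : m * (1 + s ^ p) ≤ G) (hup : (1 + Y) ^ a ≤ T ^ a * (1 + s) ^ p) :
    G⁻¹ ≤ √3 * 2 ^ p / m * (T ^ a * (1 + Y) ^ (-a)) := by
  have hG : 0 < G := lt_of_lt_of_le (by positivity) hGm
  have hY1 : 0 < (1 + Y) ^ a := by positivity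
  have h3 : (1 : ℝ) ≤ √3 := Real.one_le_sqrt.2 (by norm_num)
  have h2 := one_add_rpow_le hs hp
  rw [Real.rpow_neg (by positivity), ← mul_assoc, ← div_eq_mul_inv, le_div_iff₀ hY1,
    inv_mul_le_iff₀ hG]
  calc (1 + Y) ^ a ≤ T ^ a * (2 ^ p * (1 + s ^ p)) := hup.trans (by gcongr)
    _ = (m * (1 + s ^ p)) * (1 * 2 ^ p / m * T ^ a) := by field_simp
    _ ≤ G * (√3 * 2 ^ p / m * T ^ a) := by gcongr

lemma le_rpow_of_growth {p a c G s Y : ℝ} (hp : 0 ≤ p) (hpa : (1 + p) * a = p) (hc : 0 < c)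
    (hs : 0 ≤ s) (hY : 0 ≤ Y) (hG : c * s ^ p ≤ G) (hlow : G * s ≤ Y) :
    s ≤ c ^ (a - 1) * Y ^ (1 - a) := by
  have h1 : c * s ^ (1 + p) ≤ Y := by
    rcases hs.eq_or_lt with h0 | h0
    · rw [← h0, Real.zero_rpow (by positivity), mul_zero]
      exact hY
    · rw [Real.rpow_add h0, Real.rpow_one]
      nlinarith
  have h1a : (1 + p) * (1 - a) = 1 := by linarith
  have h1a0 : 0 ≤ 1 - a := by
    by_contra! h
    nlinarith
  have h2 := Real.rpow_le_rpow (by positivity) h1 h1a0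
  rw [Real.mul_rpow hc.le (by positivity), ← Real.rpow_mul hs, h1a, Real.rpow_one] at h2
  rw [← neg_sub, Real.rpow_neg hc.le, ← div_eq_inv_mul, le_div_iff₀ (by positivity)]
  linarith

lemma le_mul_of_growth {p a m T G s Y : ℝ} (hm : 0 < m) (hT : 0 < T) (hs : 0 ≤ s) (hY : 0 ≤ Y)
    (hGm : m * (1 + s ^ p) ≤ G) (hlow : G * s ≤ Y)
    (hup : ∀ t, 1 ≤ t → s ≤ t → (1 + Y) ^ a ≤ T ^ a * t ^ p) :
    s ≤ m⁻¹ * (T ^ a * Y * (1 + Y) ^ (-a)) := by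
  have hsp : 0 ≤ s ^ p := Real.rpow_nonneg hs p
  have hY1 : 0 < (1 + Y) ^ a := by positivity
  have hTa : 0 < T ^ a := by positivity
  rw [Real.rpow_neg (by positivity), ← div_eq_mul_inv, ← div_eq_inv_mul, le_div_iff₀ hm,
    le_div_iff₀ hY1]
  have hsG : m * (1 + s ^ p) * s ≤ Y := (mul_le_mul_of_nonneg_right hGm hs).trans hlow
  have hms : 0 ≤ m * s := by positivity
  rcases le_total s 1 with h | h
  · have h2 := hup 1 le_rfl h
    rw [Real.one_rpow, mul_one] at h2
    have h3 : s * m ≤ Y := by nlinarith [mul_nonneg hms hsp]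
    rw [mul_comm]
    gcongr
  · have h3 : s ^ p * (s * m) ≤ Y := by nlinarith
    calc s * m * (1 + Y) ^ a ≤ s * m * (T ^ a * s ^ p) := by gcongr; exact hup s h le_rfl
      _ = T ^ a * (s ^ p * (s * m)) := by ring
      _ ≤ T ^ a * Y := by gcongr

/-- Assembles the factors with exponents `a` into one with exponent `2 a`. -/
lemma mul_bounds_eq_two_mul {R c c' T Y a : ℝ} (hT : 0 < T) (hY : 0 ≤ Y) :
    R * (c * (T ^ a * Y * (1 + Y) ^ (-a)) * (c' * (T ^ a * (1 + Y) ^ (-a)))) =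
      c * c' * R * T ^ (2 * a) * Y * (1 + Y) ^ (-(2 * a)) := by
  rw [two_mul, neg_add, Real.rpow_add hT, Real.rpow_add (by positivity)]
  ring

theorem stmt5
    (N : ℕ) (hN : 1 ≤ N)
    (α' : Fin (N + 1) → ℝ) (hα0 : α' 0 = 0) (hαmono : StrictMono α')
    (A : Fin (N + 1) → ℝ) (hA : ∀ i, 0 < A i)
    (k : E3) (hk : ‖k‖ = 1)
    (Rs : ℝ) (hRs : 0 ≤ Rs)
    (X : ℝ → E3 → E3)
    (hX : ∀ z y, gFun N α' A ‖X z y‖ • X z y + (Rs * z) • cross3 k (X z y) = y)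
    (hXC1 : ContDiff ℝ 1 (fun p : ℝ × E3 => X p.1 p.2))
    (a χ₀ c₂ c₃ c₇ : ℝ)
    (ha : a = α' (Fin.last N) / (1 + α' (Fin.last N)))
    (hχ₀ : χ₀ = ∑ i, A i)
    (hc₂ : c₂ = 2 ^ a * (min 1 χ₀) ^ (-a) * (min (A 0) (A (Fin.last N)))⁻¹)
    (hc₃ : c₃ = (A (Fin.last N)) ^ (a - 1))
    (hc₇ : c₇ = Real.sqrt 3 * 2 ^ (α' (Fin.last N)) / min (A 0) (A (Fin.last N)))
    (z : ℝ) (hz : 0 ≤ z) (y : E3) :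
    ‖deriv (fun z' => X z' y) z‖
        ≤ c₂ * c₇ * Rs * (1 + χ₀ + Rs * z) ^ (2 * a) * ‖y‖ * (1 + ‖y‖) ^ (-(2 * a)) ∧
    ‖deriv (fun z' => X z' y) z‖
        ≤ c₃ * c₇ * Rs * (1 + χ₀ + Rs * z) ^ a * ‖y‖ ^ (1 - a) * (1 + ‖y‖) ^ (-a) := by
  have hα : ∀ i, 0 ≤ α' i := fun i => hα0 ▸ hαmono.monotone (Fin.zero_le i)
  have hp0 : 0 ≤ α' (Fin.last N) := hα _
  have hm0 : 0 < min (A 0) (A (Fin.last N)) := lt_min (hA _) (hA _)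
  have hs : 0 ≤ ‖X z y‖ := norm_nonneg _
  have hY : 0 ≤ ‖y‖ := norm_nonneg _
  have hb : 0 ≤ Rs * z := mul_nonneg hRs hz
  have hχ : 0 < χ₀ := hχ₀ ▸ Finset.sum_pos (fun i _ => hA i) Finset.univ_nonempty
  have hT : 0 < 1 + χ₀ + Rs * z := by positivity
  have ha0 : 0 ≤ a := ha ▸ by positivity
  have hpa : (1 + α' (Fin.last N)) * a = α' (Fin.last N) := by
    rw [ha]
    field_simp
  have hsp := Real.rpow_nonneg hs (α' (Fin.last N))
  have hGlow := le_gFun hN hα0 hA hs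
  have hGm : min (A 0) (A (Fin.last N)) * (1 + ‖X z y‖ ^ α' (Fin.last N)) ≤
      gFun N α' A ‖X z y‖ := by
    rw [mul_add, mul_one]
    exact (add_le_add (min_le_left _ _)
      (mul_le_mul_of_nonneg_right (min_le_right _ _) hsp)).trans hGlow
  have hG : 0 < gFun N α' A ‖X z y‖ := lt_of_lt_of_le (by positivity) hGm
  have hlow := mul_norm_le_of_cross3_eq (hX z y)
  have hupper : ∀ t, 1 ≤ t → ‖X z y‖ ≤ t →
      (1 + ‖y‖) ^ a ≤ (1 + χ₀ + Rs * z) ^ a * t ^ α' (Fin.last N) := fun t ht hst =>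
    one_add_rpow_le_of_growth hp0 ha0 hpa hχ.le hb hs hY ht hst
      (hχ₀ ▸ (gFun_mono hα hA hs hst).trans
        (gFun_le (fun i => hαmono.monotone (Fin.le_last i)) hA ht))
      (norm_le_of_cross3_eq hk hG.le hb (hX z y))
  have hGinv := inv_le_of_growth hp0 hm0 hT hs hY hGm (hupper _ (by linarith) (by linarith))
  rw [← hc₇] at hGinv
  have hs2 := le_rpow_of_growth hp0 hpa (hA (Fin.last N)) hs hY (by linarith [hA 0]) hlow
  rw [← hc₃] at hs2
  have hc : (min (A 0) (A (Fin.last N)))⁻¹ ≤ c₂ := by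
    rw [hc₂]
    refine le_mul_of_one_le_left (by positivity) (one_le_mul_of_one_le_of_one_le ?_ ?_)
    · exact Real.one_le_rpow (by norm_num) ha0
    · exact Real.one_le_rpow_of_pos_of_le_one_of_nonpos (by positivity) (min_le_left _ _)
        (by linarith)
  have hs1 := (le_mul_of_growth hm0 hT hs hY hGm hlow hupper).trans
    (mul_le_mul_of_nonneg_right hc (by positivity))
  have hd : DifferentiableAt ℝ (fun z' => X z' y) z :=
    ((hXC1.differentiable one_ne_zero).comp
      (differentiable_id.prodMk (differentiable_const y))).differentiableAt
  have hw : ‖deriv (fun z' => X z' y) z‖ ≤ Rs * (‖X z y‖ * (gFun N α' A ‖X z y‖)⁻¹) := by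
    rw [← mul_assoc, ← div_eq_mul_inv, le_div_iff₀ hG, mul_comm]
    exact gFun_mul_norm_deriv_le hα hA hk hRs (fun z' => hX z' y) hd
  have hGi : 0 ≤ (gFun N α' A ‖X z y‖)⁻¹ := (inv_pos.2 hG).le
  constructor
  · rw [← mul_bounds_eq_two_mul hT hY]
    exact hw.trans (mul_le_mul_of_nonneg_left (mul_le_mul hs1 hGinv hGi (hs.trans hs1)) hRs)
  · refine (hw.trans (mul_le_mul_of_nonneg_left
      (mul_le_mul hs2 hGinv hGi (hs.trans hs2)) hRs)).trans_eq ?_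
    ring
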